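/- (Main theorem: global singularity-free solution) For every β with 0 < β < √6/6 there exist functions H, φ : ℝ → ℝ, with H continuously differentiable and φ twice continuously differentiable on all of ℝ, solving the EdGB FLRW system on ℝ with the negative-branch initial data with parameter β, and such that: (A) for all t ∈ (0, +∞), 1/(5t + 1/β) < H(t) < 1/((1/2)t + 1/β) and −(12β^2 + 2√6)·ln((1/2)βt + 1) < φ(t) < −ln(1 + (3/5)·(β^2 − 1/(5t + 1/β)^2)); and (B) for all t ∈ (−∞, 0), H(t) < min{ (e^{6γt}·(1/β^2 − 4β/(5γ) + 2θ/(15γ^2)) − 2(−6βγ + θ + 6γθt)/(15γ^2))^{−1/2}, γ/(1 − 3β^3 t) }, H(t) > [β^{−1/4} − (β^{−1/4}/(4(m+1)))·(1 − (1 − 3β^3 t)^{m+1})]^{−4} > 0, and ln((1 − 3β^3 t)^2) < φ(t) < (√6·γ/(3β^3))·ln(1 − 3β^3 t) + (2β^3/(4γ + β^3))·((1 − 3β^3 t)^{(4γ + β^3)/β^3} − 1). -/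

import Mathlib

/-- The EdGB FLRW system on a set `I ⊆ ℝ`: `H` is continuously differentiable and
`φ` twice continuously differentiable on `I`, and for every `t ∈ I` the Hamiltonian
constraint `3H² − 3e^φ φ' H³ = φ'²/2` and the scalar field equation
`φ'' = −3Hφ' − 3e^φ H²(H² + H')` hold. -/
def EdGB (H φ : ℝ → ℝ) (I : Set ℝ) : Prop :=
  ContDiffOn ℝ 1 H I ∧ ContDiffOn ℝ 2 φ I ∧
  (∀ t ∈ I, 3 * H t ^ 2 - 3 * Real.exp (φ t) * deriv φ t * H t ^ 3 = (deriv φ t) ^ 2 / 2) ∧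
  (∀ t ∈ I, deriv (deriv φ) t =
      -3 * H t * deriv φ t - 3 * Real.exp (φ t) * H t ^ 2 * (H t ^ 2 + deriv H t))

/-- The negative-branch initial data with parameter `β`:
`H(0) = β`, `φ(0) = 0`, `φ'(0) = −3β³ − √(9β⁶ + 6β²)`, with `0 < β < √6/6`. -/
def NegBranchData (H φ : ℝ → ℝ) (β : ℝ) : Prop :=
  0 < β ∧ β < Real.sqrt 6 / 6 ∧ H 0 = β ∧ φ 0 = 0 ∧
  deriv φ 0 = -3 * β ^ 3 - Real.sqrt (9 * β ^ 6 + 6 * β ^ 2)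

noncomputable section

/-- `γ = (3β³ + √(9β⁶+12))/2`. -/
def gammaβ (β : ℝ) : ℝ := (3 * β ^ 3 + Real.sqrt (9 * β ^ 6 + 12)) / 2

/-- `θ = 2(9β⁶ + β³√(9β⁶+12))/(√(9β⁶+12) + 3β³)²`. -/
def thetaβ (β : ℝ) : ℝ :=
  2 * (9 * β ^ 6 + β ^ 3 * Real.sqrt (9 * β ^ 6 + 12)) /
    (Real.sqrt (9 * β ^ 6 + 12) + 3 * β ^ 3) ^ 2

/-- `m = (107√(9β⁶+12) + 309β³)/(60β³)`. -/
def mβ (β : ℝ) : ℝ := (107 * Real.sqrt (9 * β ^ 6 + 12) + 309 * β ^ 3) / (60 * β ^ 3)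

/-- The upper bound for `H` on the past evolution. -/
def Hupper (β t : ℝ) : ℝ :=
  min ((Real.exp (6 * gammaβ β * t) *
        (1 / β ^ 2 - 4 * β / (5 * gammaβ β) + 2 * thetaβ β / (15 * (gammaβ β) ^ 2)) -
      2 * (-6 * β * gammaβ β + thetaβ β + 6 * gammaβ β * thetaβ β * t) /
        (15 * (gammaβ β) ^ 2)) ^ (-(1 / 2) : ℝ))
    (gammaβ β / (1 - 3 * β ^ 3 * t))

/-- The lower bound for `H` on the past evolution. -/
def Hlower (β t : ℝ) : ℝ :=
  (β ^ (-(1 / 4) : ℝ) -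
      β ^ (-(1 / 4) : ℝ) / (4 * (mβ β + 1)) *
        (1 - (1 - 3 * β ^ 3 * t) ^ (mβ β + 1))) ^ (-4 : ℝ)

/-- The upper bound for `φ` on the past evolution. -/
def phiupper (β t : ℝ) : ℝ :=
  Real.sqrt 6 * gammaβ β / (3 * β ^ 3) * Real.log (1 - 3 * β ^ 3 * t) +
    2 * β ^ 3 / (4 * gammaβ β + β ^ 3) *
      ((1 - 3 * β ^ 3 * t) ^ ((4 * gammaβ β + β ^ 3) / β ^ 3) - 1)

end


/-- For `H > 0` the negative branch of the constraint reads `φ' = -H * branchRate (e^φ H²)`. -/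
noncomputable def branchRate (x : ℝ) : ℝ := 3 * x + Real.sqrt (9 * x ^ 2 + 6)

/-- The ratio `H' / H²` on the negative branch, as a rational function of `p = branchRate x`. -/
noncomputable def hubbleSlope (p : ℝ) : ℝ :=
  (2 * p ^ 5 - 5 * p ^ 4 - 12 * p ^ 3 - 36 * p ^ 2 - 36) / (5 * p ^ 4 - 12 * p ^ 2 + 36)

lemma branchRate_sq (x : ℝ) : branchRate x ^ 2 = 6 * x * branchRate x + 6 := by
  have h := Real.sq_sqrt (show (0 : ℝ) ≤ 9 * x ^ 2 + 6 by positivity)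
  unfold branchRate
  nlinarith

lemma branchRate_pos {x : ℝ} (hx : 0 < x) : 0 < branchRate x := by
  unfold branchRate; positivity

lemma six_lt_branchRate_sq {x : ℝ} (hx : 0 < x) : 6 < branchRate x ^ 2 := by
  have := branchRate_pos hx
  rw [branchRate_sq]
  have : 0 < 6 * x * branchRate x := by positivity
  linarith

lemma twelve_fifths_lt_branchRate {x : ℝ} (hx : 0 < x) : 12 / 5 < branchRate x := by
  have := branchRate_pos hx
  have := six_lt_branchRate_sq hx
  nlinarith

lemma mul_six_lt_branchRate {x : ℝ} (hx : 0 < x) : 6 * x < branchRate x := by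
  have := branchRate_pos hx
  have := branchRate_sq x
  nlinarith

lemma branchRate_lt {x : ℝ} (hx : 0 < x) : branchRate x < 6 * x + Real.sqrt 6 := by
  have h1 := branchRate_sq x
  have h2 := branchRate_pos hx
  have h3 := Real.sq_sqrt (show (0 : ℝ) ≤ 6 by norm_num)
  have h4 : 0 < Real.sqrt 6 := by positivity
  by_contra! h
  nlinarith [mul_pos hx h4]

lemma branchRate_le_three {x : ℝ} (hx : 0 < x) (h : x ≤ 1 / 6) : branchRate x ≤ 3 := by
  have h1 := branchRate_sq x
  have h2 := branchRate_pos hx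
  by_contra! h
  nlinarith

lemma sqrt_six_bounds : 12 / 5 < Real.sqrt 6 ∧ Real.sqrt 6 < 5 / 2 := by
  constructor
  · rw [Real.lt_sqrt (by norm_num)]; norm_num
  · rw [Real.sqrt_lt' (by norm_num)]; norm_num

lemma slope_denom_pos (p : ℝ) : 0 < 5 * p ^ 4 - 12 * p ^ 2 + 36 := by
  nlinarith [sq_nonneg (p ^ 2 - 6 / 5)]

lemma two_mul_hubbleSlope_lt {p : ℝ} (hp : 0 < p) : 2 * hubbleSlope p < p := by
  have := slope_denom_pos p
  unfold hubbleSlope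
  rw [← mul_div_assoc, div_lt_iff₀ this]
  have : 0 < p ^ 5 + 10 * p ^ 4 + 12 * p ^ 3 + 72 * p ^ 2 + 36 * p + 72 := by positivity
  linarith

lemma neg_three_lt_hubbleSlope {p : ℝ} (hp : 12 / 5 < p) (hp' : 6 < p ^ 2) :
    -3 < hubbleSlope p := by
  have := slope_denom_pos p
  unfold hubbleSlope
  rw [lt_div_iff₀ this]
  have h1 : 0 < p ^ 3 := by positivity
  have : 0 < (p ^ 2 - 6) * (2 * p ^ 3 + 10 * p ^ 2 - 12) :=
    mul_pos (by linarith) (by linarith)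
  nlinarith

lemma hubbleSlope_lt_neg_half {p : ℝ} (hp : 0 < p) (hp' : p ≤ 3) : hubbleSlope p < -1 / 2 := by
  have := slope_denom_pos p
  unfold hubbleSlope
  rw [div_lt_iff₀ this]
  have h1 : p ^ 5 ≤ 3 * p ^ 4 := by
    have : 0 ≤ p ^ 4 * (3 - p) := mul_nonneg (by positivity) (by linarith)
    linarith
  have h2 : p ^ 4 ≤ 3 * p ^ 3 := by
    have : 0 ≤ p ^ 3 * (3 - p) := mul_nonneg (by positivity) (by linarith)
    linarith
  have h3 : 0 < p ^ 3 := by positivity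
  nlinarith [sq_nonneg p]

lemma le_three_mul_hubbleSlope {p : ℝ} (hp : 18 ≤ p) : p ≤ 3 * hubbleSlope p := by
  have := slope_denom_pos p
  unfold hubbleSlope
  rw [← mul_div_assoc, le_div_iff₀ this]
  obtain ⟨q, rfl⟩ : ∃ q, p = q + 18 := ⟨p - 18, by ring⟩
  have hq : 0 ≤ q := by linarith
  have : 0 ≤ q ^ 5 ∧ 0 ≤ q ^ 4 ∧ 0 ≤ q ^ 3 ∧ 0 ≤ q ^ 2 := by refine ⟨?_, ?_, ?_, ?_⟩ <;> positivity
  obtain ⟨h5, h4, h3, h2⟩ := this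
  ring_nf
  linarith

lemma hubbleSlope_branchRate_lt {x : ℝ} (hx : 0 < x) :
    hubbleSlope (branchRate x) < 12 / 5 * x := by
  have h1 := branchRate_sq x
  have h2 := branchRate_pos hx
  have h3 := twelve_fifths_lt_branchRate hx
  generalize branchRate x = p at *
  have hx : x = (p ^ 2 - 6) / (6 * p) := by field_simp; linarith
  have := slope_denom_pos p
  unfold hubbleSlope
  rw [hx, ← mul_div_assoc, div_lt_div_iff₀ this (by positivity)]
  obtain ⟨q, rfl⟩ : ∃ q, p = q + 12 / 5 := ⟨p - 12 / 5, by ring⟩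
  have hq : 0 ≤ q := by linarith
  have : 0 ≤ q ^ 5 ∧ 0 ≤ q ^ 4 ∧ 0 ≤ q ^ 3 ∧ 0 ≤ q ^ 2 := by refine ⟨?_, ?_, ?_, ?_⟩ <;> positivity
  obtain ⟨h5, h4, h3, h2⟩ := this
  nlinarith

lemma lt_hubbleSlope_branchRate {x : ℝ} (hx : 0 < x) :
    12 / 5 * x - 3 < hubbleSlope (branchRate x) := by
  have h1 := branchRate_sq x
  have h2 := branchRate_pos hx
  have h3 := twelve_fifths_lt_branchRate hx
  have h6 := six_lt_branchRate_sq hx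
  generalize branchRate x = p at *
  have hx : x = (p ^ 2 - 6) / (6 * p) := by field_simp; linarith
  have hd := slope_denom_pos p
  have e : hubbleSlope p = (p ^ 2 - 6) * (2 * p ^ 3 + 10 * p ^ 2 - 12) /
      (5 * p ^ 4 - 12 * p ^ 2 + 36) - 3 := by
    rw [eq_sub_iff_add_eq, hubbleSlope, div_add' _ _ _ hd.ne']
    congr 1; ring
  have e' : 12 / 5 * x = (p ^ 2 - 6) * (2 / (5 * p)) := by rw [hx]; field_simp; ring
  rw [e, e', mul_div_assoc]
  have : 2 / (5 * p) < (2 * p ^ 3 + 10 * p ^ 2 - 12) / (5 * p ^ 4 - 12 * p ^ 2 + 36) := by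
    rw [div_lt_div_iff₀ (by positivity) hd]
    nlinarith [mul_pos h2 (show 0 < p ^ 2 - 6 by linarith)]
  have := mul_lt_mul_of_pos_left this (show 0 < p ^ 2 - 6 by linarith)
  linarith

lemma one_lt_branchRate_sub_hubbleSlope {x : ℝ} (hx : 0 < x) :
    1 < branchRate x - hubbleSlope (branchRate x) := by
  have := two_mul_hubbleSlope_lt (branchRate_pos hx)
  have := twelve_fifths_lt_branchRate hx
  linarith

lemma branchRate_sub_three_mul_hubbleSlope_lt {x : ℝ} (hx : 0 < x) :
    branchRate x - 3 * hubbleSlope (branchRate x) < 12 := by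
  have h3 := twelve_fifths_lt_branchRate hx
  have h6 := six_lt_branchRate_sq hx
  generalize branchRate x = p at *
  have hd := slope_denom_pos p
  unfold hubbleSlope
  rw [sub_lt_iff_lt_add, ← mul_div_assoc, ← sub_lt_iff_lt_add', lt_div_iff₀ hd]
  obtain ⟨q, rfl⟩ : ∃ q, p = q + 12 / 5 := ⟨p - 12 / 5, by ring⟩
  have hq : 0 ≤ q := by linarith
  have : 0 ≤ q ^ 5 ∧ 0 ≤ q ^ 4 ∧ 0 ≤ q ^ 3 ∧ 0 ≤ q ^ 2 := by refine ⟨?_, ?_, ?_, ?_⟩ <;> positivity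
  obtain ⟨h5, h4, h3, h2⟩ := this
  nlinarith

lemma sqrt_mul_slope_defect_le {x : ℝ} (hx : 0 < x) :
    Real.sqrt x * (branchRate x - 11 / 4 * hubbleSlope (branchRate x)) ≤ 18 := by
  have h1 := branchRate_sq x
  have h2 := branchRate_pos hx
  have h3 := twelve_fifths_lt_branchRate hx
  have h4 : Real.sqrt x ≤ (1 + x) / 2 := by
    rw [Real.sqrt_le_left (by positivity)]
    nlinarith [sq_nonneg (1 - x)]
  have h5 := Real.sqrt_nonneg x
  generalize branchRate x = p at *
  rcases le_or_gt (p - 11 / 4 * hubbleSlope p) 0 with h | h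
  · nlinarith
  · refine (mul_le_mul_of_nonneg_right h4 h.le).trans ?_
    have hx : x = (p ^ 2 - 6) / (6 * p) := by field_simp; linarith
    have hd := slope_denom_pos p
    have e : (1 + x) / 2 * (p - 11 / 4 * hubbleSlope p) =
      (p ^ 2 + 6 * p - 6) * (4 * p * (5 * p ^ 4 - 12 * p ^ 2 + 36) -
        11 * (2 * p ^ 5 - 5 * p ^ 4 - 12 * p ^ 3 - 36 * p ^ 2 - 36)) /
       (48 * p * (5 * p ^ 4 - 12 * p ^ 2 + 36)) := by
      have hd' := hd.ne'
      rw [hx, hubbleSlope, eq_div_iff (by positivity)]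
      generalize hD : 5 * p ^ 4 - 12 * p ^ 2 + 36 = D at *
      field_simp
      ring
    rw [e, div_le_iff₀ (by positivity)]
    obtain ⟨q, rfl⟩ : ∃ q, p = q + 12 / 5 := ⟨p - 12 / 5, by ring⟩
    have hq : 0 ≤ q := by linarith
    have : 0 ≤ q ^ 7 ∧ 0 ≤ q ^ 6 ∧ 0 ≤ q ^ 5 ∧ 0 ≤ q ^ 4 ∧ 0 ≤ q ^ 3 ∧ 0 ≤ q ^ 2 := by
      refine ⟨?_, ?_, ?_, ?_, ?_, ?_⟩ <;> positivity
    obtain ⟨h7, h6, h5, h4, h3, h2⟩ := this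
    ring_nf
    nlinarith

lemma continuous_branchRate : Continuous branchRate := by
  unfold branchRate; fun_prop

lemma continuous_hubbleSlope : Continuous hubbleSlope := by
  unfold hubbleSlope
  exact Continuous.div (by fun_prop) (by fun_prop) fun p => (slope_denom_pos p).ne'

lemma hasDerivAt_branchRate (x : ℝ) :
    HasDerivAt branchRate (3 * branchRate x / (branchRate x - 3 * x)) x := by
  have h0 : 0 < 9 * x ^ 2 + 6 := by positivity
  have h1 : 0 < Real.sqrt (9 * x ^ 2 + 6) := by positivity
  have h2 : HasDerivAt (fun x : ℝ => 9 * x ^ 2 + 6) (18 * x) x := by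
    exact ((((hasDerivAt_id' x).fun_pow 2).const_mul 9).add_const 6).congr_deriv (by norm_num; ring)
  have h3 := ((hasDerivAt_id x).const_mul 3).add (h2.sqrt h0.ne')
  refine h3.congr_deriv ?_
  unfold branchRate
  have : 3 * x + Real.sqrt (9 * x ^ 2 + 6) - 3 * x = Real.sqrt (9 * x ^ 2 + 6) := by ring
  rw [this]
  field_simp
  ring

/-- A differentiable function with derivative bounded below by a positive constant has a
globally defined differentiable inverse. -/
lemma exists_hasDerivAt_inverse {F f : ℝ → ℝ} (hF : ∀ s, HasDerivAt F (f s) s) {c : ℝ}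
    (hc : 0 < c) (hf : ∀ s, c ≤ f s) :
    ∃ g : ℝ → ℝ, (∀ s, g (F s) = s) ∧ ∀ t, HasDerivAt g (f (g t))⁻¹ t := by
  have hmono : StrictMono F := strictMono_of_hasDerivAt_pos hF fun s => hc.trans_le (hf s)
  have hcont : Continuous F := continuous_iff_continuousAt.2 fun s => (hF s).continuousAt
  have hlin : Monotone fun s => F s - c * s := by
    refine monotone_of_hasDerivAt_nonneg
      (f' := fun s => f s - c) (fun s => ?_) fun s => sub_nonneg.2 (hf s)
    simpa using (hF s).fun_sub ((hasDerivAt_id s).const_mul c)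
  have hsurj : Function.Surjective F := by
    refine hcont.surjective ?_ ?_
    · refine Filter.tendsto_atTop_mono' _ (f₁ := fun s => F 0 + c * s) ?_ ?_
      · filter_upwards [Filter.eventually_ge_atTop 0] with s hs
        have := hlin hs
        simp only at this
        linarith
      · exact Filter.tendsto_atTop_add_const_left _ _ (Filter.tendsto_id.const_mul_atTop hc)
    · refine Filter.tendsto_atBot_mono' _ (f₁ := fun s => F 0 + c * s) ?_ ?_
      · filter_upwards [Filter.eventually_le_atBot 0] with s hs
        have := hlin hs
        simp only at this
        linarith
      · exact Filter.tendsto_atBot_add_const_left _ _ (Filter.tendsto_id.const_mul_atBot hc)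
  let e := (hmono.orderIsoOfSurjective F hsurj)
  have he : ∀ t, F (e.symm t) = t := fun t => e.apply_symm_apply t
  refine ⟨e.symm, fun s => e.symm_apply_apply s, fun t => ?_⟩
  exact HasDerivAt.of_local_left_inverse e.symm.continuous.continuousAt (hF _)
    (hc.trans_le (hf _)).ne' (Filter.Eventually.of_forall he)

/-- Solutions of the negative branch with `H > 0`, as an autonomous first order system in `H`, `φ`
and the auxiliary quantity `x = e^φ H²`. -/
structure BranchSolution (β : ℝ) (H φ x : ℝ → ℝ) : Prop where
  H_zero : H 0 = β
  phi_zero : φ 0 = 0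
  H_pos : ∀ t, 0 < H t
  x_eq : ∀ t, x t = Real.exp (φ t) * H t ^ 2
  hasDerivAt_H : ∀ t, HasDerivAt H (H t ^ 2 * hubbleSlope (branchRate (x t))) t
  hasDerivAt_phi : ∀ t, HasDerivAt φ (-(branchRate (x t) * H t)) t

/-- The logarithmic derivative of `H` with respect to `log (e^φ H²)`. -/
noncomputable def logSlope (s : ℝ) : ℝ :=
  -hubbleSlope (branchRate (Real.exp s)) /
    (branchRate (Real.exp s) - 2 * hubbleSlope (branchRate (Real.exp s)))

lemma logSlope_denom_pos (s : ℝ) :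
    0 < branchRate (Real.exp s) - 2 * hubbleSlope (branchRate (Real.exp s)) :=
  sub_pos.2 (two_mul_hubbleSlope_lt (branchRate_pos (Real.exp_pos s)))

lemma continuous_logSlope : Continuous logSlope := by
  have h1 := continuous_branchRate.comp Real.continuous_exp
  have h2 := continuous_hubbleSlope.comp h1
  exact h2.neg.div (h1.sub (continuous_const.mul h2)) fun s => (logSlope_denom_pos s).ne'

lemma logSlope_nonneg {s : ℝ} (hs : Real.exp s ≤ 1 / 6) : 0 ≤ logSlope s := by
  have h1 := Real.exp_pos s
  have := hubbleSlope_lt_neg_half (branchRate_pos h1) (branchRate_le_three h1 hs)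
  exact div_nonneg (by linarith) (logSlope_denom_pos s).le

lemma logSlope_le_neg_one {s : ℝ} (hs : 3 ≤ Real.exp s) : logSlope s ≤ -1 := by
  have h1 := mul_six_lt_branchRate (Real.exp_pos s)
  have := le_three_mul_hubbleSlope (show 18 ≤ branchRate (Real.exp s) by linarith)
  rw [logSlope, div_le_iff₀ (logSlope_denom_pos s)]
  linarith

/-- A continuously differentiable function that increases near `-∞` and decreases near `+∞` is
bounded above. -/
lemma exists_le_of_hasDerivAt_sign {Z Z' : ℝ → ℝ} {a b : ℝ} (hZ : ∀ s, HasDerivAt Z (Z' s) s)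
    (ha : ∀ s ≤ a, 0 ≤ Z' s) (hb : ∀ s, b ≤ s → Z' s ≤ 0) : ∃ M, ∀ s, Z s ≤ M := by
  have hc : Continuous Z := continuous_iff_continuousAt.2 fun s => (hZ s).continuousAt
  obtain ⟨M, hM⟩ := (isCompact_Icc (a := min a b) (b := max a b)).bddAbove_image hc.continuousOn
  have hM' : ∀ s ∈ Set.Icc (min a b) (max a b), Z s ≤ M := fun s hs => hM ⟨s, hs, rfl⟩
  refine ⟨M, fun s => ?_⟩
  rcases le_or_gt s a with h | h
  · have : MonotoneOn Z (Set.Iic a) := by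
      refine monotoneOn_of_hasDerivWithinAt_nonneg (convex_Iic a) hc.continuousOn
        (fun s _ => (hZ s).hasDerivWithinAt) fun s hs => ha s ?_
      rw [interior_Iic] at hs
      exact le_of_lt hs
    exact (this h (Set.mem_Iic.2 le_rfl) h).trans (hM' a ⟨min_le_left _ _, le_max_left _ _⟩)
  rcases le_or_gt b s with h' | h'
  · have : AntitoneOn Z (Set.Ici b) := by
      refine antitoneOn_of_hasDerivWithinAt_nonpos (convex_Ici b) hc.continuousOn
        (fun s _ => (hZ s).hasDerivWithinAt) fun s hs => hb s ?_
      rw [interior_Ici] at hs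
      exact le_of_lt hs
    exact (this (Set.mem_Ici.2 le_rfl) h' h').trans (hM' b ⟨min_le_right _ _, le_max_right _ _⟩)
  · exact hM' s ⟨(min_le_left _ _).trans h.le, h'.le.trans (le_max_right _ _)⟩

/-- Along the negative branch the speed of `log (e^φ H²)` is bounded. -/
lemma exists_speed_bound {A : ℝ → ℝ} (hA : ∀ s, HasDerivAt A (logSlope s) s) :
    ∃ M, 0 < M ∧ ∀ s, Real.exp (A s) *
      (branchRate (Real.exp s) - 2 * hubbleSlope (branchRate (Real.exp s))) ≤ M := by
  have hZ : ∀ s, HasDerivAt (fun s => Real.exp (A s) * (1 + Real.exp s))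
      (Real.exp (A s) * (logSlope s * (1 + Real.exp s) + Real.exp s)) s := fun s =>
    ((hA s).exp.mul ((Real.hasDerivAt_exp s).const_add 1)).congr_deriv (by ring)
  obtain ⟨M, hM⟩ := exists_le_of_hasDerivAt_sign (a := Real.log (1 / 6)) (b := Real.log 3) hZ
    (fun s hs => by
      have h1 := Real.exp_pos s
      have := logSlope_nonneg ((Real.le_log_iff_exp_le (by norm_num)).1 hs)
      positivity)
    (fun s hs => by
      have h1 := Real.exp_pos s
      have h2 := Real.exp_pos (A s)
      have := logSlope_le_neg_one ((Real.log_le_iff_le_exp (by norm_num)).1 hs)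
      refine mul_nonpos_of_nonneg_of_nonpos h2.le ?_
      nlinarith)
  refine ⟨9 * M, ?_, fun s => ?_⟩
  · have := hM 0
    have h2 : 0 < Real.exp (A 0) * (1 + Real.exp 0) := by positivity
    linarith
  · have h1 := Real.exp_pos s
    have h3 := neg_three_lt_hubbleSlope (twelve_fifths_lt_branchRate h1) (six_lt_branchRate_sq h1)
    have h4 := branchRate_lt h1
    have h5 := sqrt_six_bounds.2
    have h6 : Real.exp (A s) *
      (branchRate (Real.exp s) - 2 * hubbleSlope (branchRate (Real.exp s))) ≤
        Real.exp (A s) * (9 * (1 + Real.exp s)) :=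
      mul_le_mul_of_nonneg_left (by linarith) (Real.exp_pos _).le
    have := hM s
    linarith

lemma exists_branchSolution {β : ℝ} (hβ : 0 < β) : ∃ H φ x : ℝ → ℝ, BranchSolution β H φ x := by
  set s₀ := 2 * Real.log β with hs₀
  obtain ⟨A, hA0, hA⟩ : ∃ A : ℝ → ℝ, A s₀ = Real.log β ∧ ∀ s, HasDerivAt A (logSlope s) s :=
    ⟨fun s => Real.log β + ∫ r in s₀..s, logSlope r, by simp, fun s =>
      (continuous_logSlope.integral_hasStrictDerivAt s₀ s).hasDerivAt.const_add _⟩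
  obtain ⟨M, hM, hAM⟩ := exists_speed_bound hA
  let v : ℝ → ℝ := fun s => Real.exp (A s) *
    (branchRate (Real.exp s) - 2 * hubbleSlope (branchRate (Real.exp s)))
  have hv : ∀ s, 0 < v s := fun s => mul_pos (Real.exp_pos _) (logSlope_denom_pos s)
  have hvc : Continuous v := by
    have h0 : Continuous A := continuous_iff_continuousAt.2 fun s => (hA s).continuousAt
    have h1 := continuous_branchRate.comp Real.continuous_exp
    have h2 := continuous_hubbleSlope.comp h1
    exact (Real.continuous_exp.comp h0).mul (h1.sub (continuous_const.mul h2))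
  have hvi : Continuous fun s => (v s)⁻¹ := hvc.inv₀ fun s => (hv s).ne'
  obtain ⟨g, hg, hg'⟩ := exists_hasDerivAt_inverse
    (F := fun s => ∫ r in s₀..s, (v r)⁻¹) (f := fun s => (v s)⁻¹) (c := M⁻¹)
    (fun s => (hvi.integral_hasStrictDerivAt s₀ s).hasDerivAt) (inv_pos.2 hM)
    (fun s => inv_anti₀ (hv s) (hAM s))
  have hg0 : g 0 = s₀ := by simpa using hg s₀
  simp only [inv_inv] at hg'
  have hσ : ∀ t, HasDerivAt (fun t => g (-t)) (-v (g (-t))) t := fun t =>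
    ((hg' (-t)).comp t (hasDerivAt_neg t)).congr_deriv (by ring)
  have hAσ : ∀ t, HasDerivAt (fun t => A (g (-t))) (logSlope (g (-t)) * -v (g (-t))) t := fun t =>
    (hA (g (-t))).comp t (hσ t)
  have hvA : ∀ s, logSlope s * -v s = Real.exp (A s) * hubbleSlope (branchRate (Real.exp s)) := by
    intro s
    have := (logSlope_denom_pos s).ne'
    simp only [logSlope, v]
    generalize branchRate (Real.exp s) - 2 * hubbleSlope (branchRate (Real.exp s)) = d at *
    field_simp
  refine ⟨fun t => Real.exp (A (g (-t))), fun t => g (-t) - 2 * A (g (-t)),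
    fun t => Real.exp (g (-t)), ?_, ?_, fun t => Real.exp_pos _, fun t => ?_, fun t => ?_,
    fun t => ?_⟩
  · simp [hg0, hA0, Real.exp_log hβ]
  · simp only [neg_zero, hg0, hA0]
    ring
  · rw [← Real.exp_nat_mul, ← Real.exp_add]
    congr 1
    push_cast
    ring
  · refine (hAσ t).exp.congr_deriv ?_
    rw [hvA]
    ring
  · refine ((hσ t).fun_sub ((hAσ t).const_mul 2)).congr_deriv ?_
    rw [hvA]
    simp only [v]
    ring

lemma pos_of_hasDerivAt_pos {f f' : ℝ → ℝ} (h0 : f 0 = 0) (hf : ∀ t, 0 ≤ t → HasDerivAt f (f' t) t)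
    (hf' : ∀ t, 0 < t → 0 < f' t) {t : ℝ} (ht : 0 < t) : 0 < f t := by
  have : StrictMonoOn f (Set.Ici 0) :=
    strictMonoOn_of_hasDerivWithinAt_pos (convex_Ici 0)
      (fun s hs => (hf s hs).continuousAt.continuousWithinAt)
      (fun s hs => (hf s (Set.mem_Ici.1 (interior_subset hs))).hasDerivWithinAt)
      fun s hs => hf' s (by simpa using hs)
  simpa [h0] using this Set.self_mem_Ici ht.le ht

lemma pos_of_hasDerivAt_neg {f f' : ℝ → ℝ} (h0 : f 0 = 0) (hf : ∀ t ≤ 0, HasDerivAt f (f' t) t)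
    (hf' : ∀ t < 0, f' t < 0) {t : ℝ} (ht : t < 0) : 0 < f t := by
  have : StrictAntiOn f (Set.Iic 0) :=
    strictAntiOn_of_hasDerivWithinAt_neg (convex_Iic 0)
      (fun s hs => (hf s hs).continuousAt.continuousWithinAt)
      (fun s hs => (hf s (Set.mem_Iic.1 (interior_subset hs))).hasDerivWithinAt)
      fun s hs => hf' s (by simpa using hs)
  simpa [h0] using this ht.le Set.self_mem_Iic ht

namespace BranchSolution

variable {β : ℝ} {H φ x : ℝ → ℝ}

lemma x_pos (S : BranchSolution β H φ x) (t : ℝ) : 0 < x t := by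
  rw [S.x_eq]
  have := S.H_pos t
  positivity

lemma x_zero (S : BranchSolution β H φ x) : x 0 = β ^ 2 := by
  rw [S.x_eq, S.phi_zero, S.H_zero, Real.exp_zero, one_mul]

lemma hasDerivAt_x (S : BranchSolution β H φ x) (t : ℝ) :
    HasDerivAt x (-(x t * H t * (branchRate (x t) - 2 * hubbleSlope (branchRate (x t))))) t := by
  have h : x = fun t => Real.exp (φ t) * H t ^ 2 := funext S.x_eq
  have := (S.hasDerivAt_phi t).exp.fun_mul ((S.hasDerivAt_H t).fun_pow 2)
  rw [← h] at this
  refine this.congr_deriv ?_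
  generalize branchRate (x t) = p
  rw [S.x_eq]
  push_cast
  ring

lemma strictAnti_x (S : BranchSolution β H φ x) : StrictAnti x :=
  strictAnti_of_hasDerivAt_neg S.hasDerivAt_x fun t => by
    have h1 := S.x_pos t
    have h2 := S.H_pos t
    have h3 := sub_pos.2 (two_mul_hubbleSlope_lt (branchRate_pos h1))
    have := mul_pos (mul_pos h1 h2) h3
    linarith

lemma deriv_H (S : BranchSolution β H φ x) :
    deriv H = fun t => H t ^ 2 * hubbleSlope (branchRate (x t)) :=
  funext fun t => (S.hasDerivAt_H t).deriv

lemma deriv_phi (S : BranchSolution β H φ x) : deriv φ = fun t => -(branchRate (x t) * H t) :=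
  funext fun t => (S.hasDerivAt_phi t).deriv

lemma continuous_H (S : BranchSolution β H φ x) : Continuous H :=
  continuous_iff_continuousAt.2 fun t => (S.hasDerivAt_H t).continuousAt

lemma continuous_x (S : BranchSolution β H φ x) : Continuous x :=
  continuous_iff_continuousAt.2 fun t => (S.hasDerivAt_x t).continuousAt

lemma hasDerivAt_deriv_phi (S : BranchSolution β H φ x) (t : ℝ) :
    HasDerivAt (deriv φ) (3 * branchRate (x t) * H t ^ 2 -
      3 * x t * (H t ^ 2 + H t ^ 2 * hubbleSlope (branchRate (x t)))) t := by
  rw [S.deriv_phi]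
  refine (((hasDerivAt_branchRate (x t)).comp t (S.hasDerivAt_x t)).mul
    (S.hasDerivAt_H t)).neg.congr_deriv ?_
  have hx := S.x_pos t
  have h1 := branchRate_sq (x t)
  have h2 := mul_six_lt_branchRate hx
  have h3 := branchRate_pos hx
  simp only [Function.comp]
  generalize x t = y at *
  generalize branchRate y = p at *
  have hd := slope_denom_pos p
  have h4 : p - 3 * y ≠ 0 := by linarith
  have hy : y = (p ^ 2 - 6) / (6 * p) := by field_simp; linarith
  have hd' := hd.ne'
  have h5 : p ^ 2 + 6 ≠ 0 := by positivity
  have e : p - 3 * y = (p ^ 2 + 6) / (2 * p) := by rw [hy]; field_simp; ring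
  rw [e, hy, hubbleSlope]
  generalize hD : 5 * p ^ 4 - 12 * p ^ 2 + 36 = D at *
  field_simp
  rw [← hD]
  ring

lemma contDiff_H (S : BranchSolution β H φ x) : ContDiff ℝ 1 H := by
  rw [contDiff_one_iff_deriv, S.deriv_H]
  exact ⟨fun t => (S.hasDerivAt_H t).differentiableAt, (S.continuous_H.pow 2).mul
    (continuous_hubbleSlope.comp (continuous_branchRate.comp S.continuous_x))⟩

lemma contDiff_phi (S : BranchSolution β H φ x) : ContDiff ℝ 2 φ := by
  rw [show (2 : WithTop ℕ∞) = 1 + 1 by norm_num, contDiff_succ_iff_deriv]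
  refine ⟨fun t => (S.hasDerivAt_phi t).differentiableAt, by simp, ?_⟩
  rw [contDiff_one_iff_deriv]
  refine ⟨fun t => (S.hasDerivAt_deriv_phi t).differentiableAt, ?_⟩
  rw [funext fun t => (S.hasDerivAt_deriv_phi t).deriv]
  have h1 := S.continuous_H
  have h2 := S.continuous_x
  have h3 := continuous_branchRate.comp h2
  have h4 := continuous_hubbleSlope.comp h3
  exact ((continuous_const.mul h3).mul (h1.pow 2)).sub
    ((continuous_const.mul h2).mul ((h1.pow 2).add ((h1.pow 2).mul h4)))

lemma edGB (S : BranchSolution β H φ x) : EdGB H φ Set.univ := by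
  refine ⟨S.contDiff_H.contDiffOn, S.contDiff_phi.contDiffOn, fun t _ => ?_, fun t _ => ?_⟩
  · have h1 := branchRate_sq (x t)
    have h2 := S.x_eq t
    rw [S.deriv_phi]
    simp only
    generalize branchRate (x t) = p at *
    linear_combination (-(H t ^ 2) / 2) * h1 - 3 * p * H t ^ 2 * h2
  · rw [(S.hasDerivAt_deriv_phi t).deriv, S.deriv_phi, S.deriv_H]
    have h2 := S.x_eq t
    simp only
    generalize hubbleSlope (branchRate (x t)) = k at *
    generalize branchRate (x t) = p at *
    rw [h2]
    ring

lemma negBranchData (S : BranchSolution β H φ x) (hβ : 0 < β) (hβ' : β < Real.sqrt 6 / 6) :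
    NegBranchData H φ β := by
  refine ⟨hβ, hβ', S.H_zero, S.phi_zero, ?_⟩
  rw [S.deriv_phi]
  simp only [S.x_zero, S.H_zero, branchRate]
  have : 9 * β ^ 6 + 6 * β ^ 2 = (9 * (β ^ 2) ^ 2 + 6) * β ^ 2 := by ring
  rw [this, Real.sqrt_mul (by positivity), Real.sqrt_sq hβ.le]
  ring

lemma H_future_bounds (S : BranchSolution β H φ x) (hβ : 0 < β) (hβ2 : β ^ 2 < 1 / 6)
    {t : ℝ} (ht : 0 < t) : 1 / (5 * t + 1 / β) < H t ∧ H t < 1 / ((1 / 2) * t + 1 / β) := by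
  have hd : ∀ s, HasDerivAt (fun s => (H s)⁻¹) (-hubbleSlope (branchRate (x s))) s := fun s => by
    have hs := (S.H_pos s).ne'
    exact (S.hasDerivAt_H s).fun_inv hs |>.congr_deriv (by field_simp)
  have hx : ∀ s, 0 < s → x s ≤ 1 / 6 := fun s hs => by
    have := S.strictAnti_x hs
    rw [S.x_zero] at this
    linarith
  have h1 : 0 < 5 * t + 1 / β - (H t)⁻¹ := by
    refine pos_of_hasDerivAt_pos (f := fun t => 5 * t + 1 / β - (H t)⁻¹)
      (f' := fun t => 5 + hubbleSlope (branchRate (x t))) (by simp [S.H_zero])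
      (fun s _ => ?_) (fun s hs => ?_) ht
    · exact ((((hasDerivAt_id' s).const_mul 5).add_const _).fun_sub (hd s)).congr_deriv (by ring)
    · have h := S.x_pos s
      have := neg_three_lt_hubbleSlope (twelve_fifths_lt_branchRate h) (six_lt_branchRate_sq h)
      linarith
  have h2 : 0 < (H t)⁻¹ - ((1 / 2) * t + 1 / β) := by
    refine pos_of_hasDerivAt_pos (f := fun t => (H t)⁻¹ - ((1 / 2) * t + 1 / β))
      (f' := fun t => -hubbleSlope (branchRate (x t)) - 1 / 2) (by simp [S.H_zero])
      (fun s _ => ?_) (fun s hs => ?_) ht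
    · exact ((hd s).fun_sub (((hasDerivAt_id' s).const_mul (1 / 2)).add_const _)).congr_deriv
        (by ring)
    · have h := S.x_pos s
      have := hubbleSlope_lt_neg_half (branchRate_pos h) (branchRate_le_three h (hx s hs))
      linarith
  have h3 := S.H_pos t
  constructor
  · rw [one_div_lt (by positivity) h3, one_div]
    linarith
  · rw [lt_one_div h3 (by positivity), one_div (H t)]
    linarith

lemma phi_future_lower (S : BranchSolution β H φ x) (hβ : 0 < β) (hβ2 : β ^ 2 < 1 / 6)
    {t : ℝ} (ht : 0 < t) :
    -(12 * β ^ 2 + 2 * Real.sqrt 6) * Real.log ((1 / 2) * β * t + 1) < φ t := by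
  have : 0 < φ t - -(12 * β ^ 2 + 2 * Real.sqrt 6) * Real.log ((1 / 2) * β * t + 1) := by
    refine pos_of_hasDerivAt_pos
      (f := fun t => φ t - -(12 * β ^ 2 + 2 * Real.sqrt 6) * Real.log ((1 / 2) * β * t + 1))
      (f' := fun t => -(branchRate (x t) * H t) +
        (6 * β ^ 2 + Real.sqrt 6) * (1 / ((1 / 2) * t + 1 / β))) (by simp [S.phi_zero])
      (fun s hs => ?_) (fun s hs => ?_) ht
    · have h1 : 0 < (1 / 2) * β * s + 1 := by positivity
      refine ((S.hasDerivAt_phi s).fun_sub (((((hasDerivAt_id' s).const_mul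
        ((1 / 2) * β)).add_const 1).log h1.ne').const_mul _)).congr_deriv ?_
      have h2 : 0 < (1 / 2) * s + 1 / β := by positivity
      have e : (1 / 2) * s + 1 / β = ((1 / 2) * β * s + 1) / β := by field_simp
      rw [e]
      field_simp
      ring
    · have h1 := (S.H_future_bounds hβ hβ2 hs).2
      have h2 := S.H_pos s
      have h3 := S.strictAnti_x hs
      have h4 := branchRate_pos (S.x_pos s)
      have h5 := branchRate_lt (S.x_pos s)
      rw [S.x_zero] at h3
      have : branchRate (x s) * H s < (6 * β ^ 2 + Real.sqrt 6) * (1 / ((1 / 2) * s + 1 / β)) :=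
        mul_lt_mul'' (by linarith) h1 h4.le h2.le
      linarith
  linarith

lemma phi_future_upper (S : BranchSolution β H φ x) (hβ : 0 < β) (hβ2 : β ^ 2 < 1 / 6)
    {t : ℝ} (ht : 0 < t) :
    φ t < -Real.log (1 + (3 / 5) * (β ^ 2 - 1 / (5 * t + 1 / β) ^ 2)) := by
  have h0 : 0 < Real.exp (-φ t) - (1 + (3 / 5) * (β ^ 2 - 1 / (5 * t + 1 / β) ^ 2)) := by
    refine pos_of_hasDerivAt_pos
      (f := fun t => Real.exp (-φ t) - (1 + (3 / 5) * (β ^ 2 - 1 / (5 * t + 1 / β) ^ 2)))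
      (f' := fun t => Real.exp (-φ t) * (branchRate (x t) * H t) - 6 * (1 / (5 * t + 1 / β)) ^ 3)
      (by simp [S.phi_zero])
      (fun s hs => ?_) (fun s hs => ?_) ht
    · have h1 : 0 < 5 * s + 1 / β := by positivity
      have hu := (((hasDerivAt_id' s).const_mul 5).add_const (1 / β)).fun_inv h1.ne'
      have h := (S.hasDerivAt_phi s).fun_neg.exp.fun_sub
        ((((hu.fun_pow 2).const_sub (β ^ 2)).const_mul (3 / 5)).const_add 1)
      simp only [one_div, ← inv_pow] at h ⊢
      refine h.congr_deriv ?_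
      rw [one_div] at h1
      generalize 5 * s + β⁻¹ = u at *
      norm_num
      field_simp
      ring
    · have h1 := (S.H_future_bounds hβ hβ2 hs).1
      have h2 := S.H_pos s
      have h4 := mul_six_lt_branchRate (S.x_pos s)
      have h5 := S.x_eq s
      have h6 : 0 < 1 / (5 * s + 1 / β) := by positivity
      have h7 : (1 / (5 * s + 1 / β)) ^ 3 < H s ^ 3 := pow_lt_pow_left₀ h1 h6.le (by norm_num)
      have h8 : Real.exp (-φ s) * (6 * x s * H s) < Real.exp (-φ s) * (branchRate (x s) * H s) :=
        mul_lt_mul_of_pos_left (mul_lt_mul_of_pos_right h4 h2) (Real.exp_pos _)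
      have h9 : Real.exp (-φ s) * (6 * x s * H s) = 6 * H s ^ 3 := by
        rw [h5, Real.exp_neg]
        field_simp
      linarith
  have h1 : 1 / (5 * t + 1 / β) ^ 2 ≤ β ^ 2 := by
    have : 1 / (5 * t + 1 / β) ≤ β := by
      rw [one_div_le (by positivity) hβ]
      linarith
    calc 1 / (5 * t + 1 / β) ^ 2 = (1 / (5 * t + 1 / β)) ^ 2 := by rw [one_div_pow]
      _ ≤ β ^ 2 := pow_le_pow_left₀ (by positivity) this 2
  have h2 := (Real.log_lt_iff_lt_exp (y := -φ t)
    (show 0 < 1 + (3 / 5) * (β ^ 2 - 1 / (5 * t + 1 / β) ^ 2) by linarith)).2 (by linarith)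
  linarith

end BranchSolution

lemma gammaβ_sq {β : ℝ} : gammaβ β ^ 2 = 3 * β ^ 3 * gammaβ β + 3 := by
  have := Real.sq_sqrt (show 0 ≤ 9 * β ^ 6 + 12 by positivity)
  unfold gammaβ
  nlinarith

lemma gammaβ_gt {β : ℝ} (hβ : 0 < β) : 173 / 100 < gammaβ β := by
  have h : (346 / 100 : ℝ) < Real.sqrt (9 * β ^ 6 + 12) := by
    rw [Real.lt_sqrt (by norm_num)]
    have : 0 < β ^ 6 := by positivity
    linarith
  have : 0 < β ^ 3 := by positivity
  unfold gammaβ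
  linarith

lemma sqrt_eq_gammaβ (β : ℝ) : Real.sqrt (9 * β ^ 6 + 12) = 2 * gammaβ β - 3 * β ^ 3 := by
  unfold gammaβ; ring

lemma thetaβ_eq {β : ℝ} : thetaβ β = β ^ 3 * (3 * β ^ 3 + gammaβ β) / gammaβ β ^ 2 := by
  rw [thetaβ, sqrt_eq_gammaβ, show 2 * gammaβ β - 3 * β ^ 3 + 3 * β ^ 3 = 2 * gammaβ β by ring,
    mul_pow, show 2 * (9 * β ^ 6 + β ^ 3 * (2 * gammaβ β - 3 * β ^ 3)) =
      4 * (β ^ 3 * (3 * β ^ 3 + gammaβ β)) by ring, show (2 : ℝ) ^ 2 = 4 by norm_num,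
    mul_div_mul_left _ _ (by norm_num)]

lemma mβ_eq {β : ℝ} : mβ β = (107 * gammaβ β - 6 * β ^ 3) / (30 * β ^ 3) := by
  rw [mβ, sqrt_eq_gammaβ, show 107 * (2 * gammaβ β - 3 * β ^ 3) + 309 * β ^ 3 =
    2 * (107 * gammaβ β - 6 * β ^ 3) by ring, show 60 * β ^ 3 = 2 * (30 * β ^ 3) by ring,
    mul_div_mul_left _ _ (by norm_num)]

lemma mβ_mul {β : ℝ} (hβ : 0 < β) : 3 * β ^ 3 * mβ β = 107 / 10 * gammaβ β - 3 / 5 * β ^ 3 := by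
  rw [mβ_eq]
  field_simp
  ring

lemma thetaβ_pos {β : ℝ} (hβ : 0 < β) : 0 < thetaβ β := by
  have := gammaβ_gt hβ
  have : 0 < gammaβ β := by linarith
  rw [thetaβ_eq]
  positivity

lemma thetaβ_le {β : ℝ} (hβ : 0 < β) (hβ1 : β < 1 / 2) : thetaβ β ≤ β ^ 2 := by
  have h1 := gammaβ_gt hβ
  have h2 : 0 < gammaβ β := by linarith
  have h3 := gammaβ_sq (β := β)
  have h4 : 0 < β ^ 3 := by positivity
  rw [thetaβ_eq, div_le_iff₀ (by positivity), show β ^ 3 * (3 * β ^ 3 + gammaβ β) =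
    β ^ 2 * (β * (3 * β ^ 3 + gammaβ β)) by ring]
  refine mul_le_mul_of_nonneg_left ?_ (by positivity)
  have : β * (3 * β ^ 3 + gammaβ β) ≤ 1 / 2 * (3 * β ^ 3 + gammaβ β) :=
    mul_le_mul_of_nonneg_right hβ1.le (by positivity)
  nlinarith

namespace BranchSolution

variable {β : ℝ} {H φ x : ℝ → ℝ}

lemma sq_lt_x (S : BranchSolution β H φ x) {t : ℝ} (ht : t < 0) : β ^ 2 < x t := by
  simpa [S.x_zero] using S.strictAnti_x ht

lemma lt_exp_half_phi (S : BranchSolution β H φ x) (hβ : 0 < β) {t : ℝ} (ht : t < 0) :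
    1 - 3 * β ^ 3 * t < Real.exp (φ t / 2) := by
  have : 0 < Real.exp (φ t / 2) - (1 - 3 * β ^ 3 * t) := by
    refine pos_of_hasDerivAt_neg (f := fun t => Real.exp (φ t / 2) - (1 - 3 * β ^ 3 * t))
      (f' := fun t => 3 * β ^ 3 - Real.exp (φ t / 2) * H t * branchRate (x t) / 2)
      (by simp [S.phi_zero]) (fun s _ => ?_) (fun s hs => ?_) ht
    · exact (((S.hasDerivAt_phi s).div_const 2).exp.fun_sub
        (((hasDerivAt_id' s).const_mul (3 * β ^ 3)).const_sub 1)).congr_deriv (by ring)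
    · have h1 := S.sq_lt_x hs
      have h2 := S.H_pos s
      have h3 : (Real.exp (φ s / 2) * H s) ^ 2 = x s := by
        rw [S.x_eq, mul_pow, ← Real.exp_nat_mul]
        congr 2
        push_cast
        ring
      have h4 : 0 < Real.exp (φ s / 2) * H s := by positivity
      have h5 : β < Real.exp (φ s / 2) * H s := by
        refine lt_of_pow_lt_pow_left₀ 2 h4.le ?_
        rwa [h3]
      have h6 := mul_six_lt_branchRate (S.x_pos s)
      have := mul_lt_mul'' h5 (show 6 * β ^ 2 < branchRate (x s) by linarith) hβ.le (by positivity)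
      nlinarith
  linarith

lemma H_mul_lt_sqrt_x (S : BranchSolution β H φ x) (hβ : 0 < β) {t : ℝ} (ht : t < 0) :
    H t * (1 - 3 * β ^ 3 * t) < Real.sqrt (x t) := by
  have h1 := S.lt_exp_half_phi hβ ht
  have h2 := S.H_pos t
  have h3 : (Real.exp (φ t / 2) * H t) ^ 2 = x t := by
    rw [S.x_eq, mul_pow, ← Real.exp_nat_mul]
    congr 2
    push_cast
    ring
  rw [← h3, Real.sqrt_sq (by positivity), mul_comm]
  exact mul_lt_mul_of_pos_right h1 h2

lemma phi_past_lower (S : BranchSolution β H φ x) (hβ : 0 < β) {t : ℝ} (ht : t < 0) :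
    Real.log ((1 - 3 * β ^ 3 * t) ^ 2) < φ t := by
  have h1 := S.lt_exp_half_phi hβ ht
  have h0 : 0 < 1 - 3 * β ^ 3 * t := by nlinarith [pow_pos hβ 3]
  rw [Real.log_lt_iff_lt_exp (by positivity)]
  calc (1 - 3 * β ^ 3 * t) ^ 2 < Real.exp (φ t / 2) ^ 2 := pow_lt_pow_left₀ h1 h0.le (by norm_num)
    _ = Real.exp (φ t) := by
      rw [← Real.exp_nat_mul]
      congr 1
      push_cast
      ring

lemma H_past_upper (S : BranchSolution β H φ x) (hβ : 0 < β) (hβ1 : β < 1 / 2)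
    {t : ℝ} (ht : t < 0) : H t < gammaβ β / (1 - 3 * β ^ 3 * t) := by
  have h0 : ∀ s < 0, 0 < 1 - 3 * β ^ 3 * s := fun s hs => by nlinarith [pow_pos hβ 3]
  have hγ := gammaβ_gt hβ
  have hγ0 : 0 < gammaβ β := by linarith
  have hβ3 : β ^ 3 < 1 / 8 := by
    calc β ^ 3 < (1 / 2) ^ 3 := pow_lt_pow_left₀ hβ1 hβ.le (by norm_num)
      _ = 1 / 8 := by norm_num
  have hsmall : ∀ s < 0, x s ≤ 5 / 2 → H s * (1 - 3 * β ^ 3 * s) < gammaβ β := fun s hs hx => by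
    refine (S.H_mul_lt_sqrt_x hβ hs).trans ?_
    rw [Real.sqrt_lt' hγ0]
    nlinarith
  rw [lt_div_iff₀ (h0 t ht)]
  rcases le_or_gt (x t) (5 / 2) with hx | hx
  · exact hsmall t ht hx
  have hγ2 := gammaβ_sq (β := β)
  have hx0 : x 0 ≤ 5 / 2 := by
    rw [S.x_zero]
    nlinarith
  obtain ⟨r, ⟨hr1, hr2⟩, hr⟩ := intermediate_value_Icc' ht.le S.continuous_x.continuousOn
    ⟨hx0, hx.le⟩
  have hr0 : r < 0 := by
    refine lt_of_le_of_ne hr2 fun h => ?_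
    rw [h, S.x_zero] at hr
    nlinarith
  have hrt : t < r := lt_of_le_of_ne hr1 fun h => by rw [h, hr] at hx; exact lt_irrefl _ hx
  have hd : ∀ s, HasDerivAt (fun s => (H s)⁻¹ - (1 - 3 * β ^ 3 * s) / gammaβ β)
      (-hubbleSlope (branchRate (x s)) + 3 * β ^ 3 / gammaβ β) s := fun s => by
    have hs := (S.H_pos s).ne'
    exact ((S.hasDerivAt_H s).fun_inv hs).fun_sub ((((hasDerivAt_id' s).const_mul
      (3 * β ^ 3)).const_sub 1).div_const (gammaβ β)) |>.congr_deriv (by field_simp; ring)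
  have hanti : StrictAntiOn (fun s => (H s)⁻¹ - (1 - 3 * β ^ 3 * s) / gammaβ β)
      (Set.Icc t r) := by
    refine strictAntiOn_of_hasDerivWithinAt_neg (convex_Icc t r)
      (fun s _ => (hd s).continuousAt.continuousWithinAt)
      (fun s _ => (hd s).hasDerivWithinAt) fun s hs => ?_
    have h1 := S.strictAnti_x.antitone (interior_subset hs).2
    have h2 := lt_hubbleSlope_branchRate (S.x_pos s)
    have h3 : 3 * β ^ 3 / gammaβ β < 1 := by
      rw [div_lt_one hγ0]
      linarith
    linarith
  have h1 := hanti ⟨le_rfl, hr1⟩ ⟨hr1, le_rfl⟩ hrt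
  have h2 := hsmall r hr0 hr.le
  have hHr := S.H_pos r
  have hHt := S.H_pos t
  have h3 : (1 - 3 * β ^ 3 * r) / gammaβ β < (H r)⁻¹ := by
    rw [div_lt_iff₀ hγ0, inv_mul_eq_div, lt_div_iff₀ hHr]
    linarith
  have h4 : (1 - 3 * β ^ 3 * t) / gammaβ β < (H t)⁻¹ := by
    simp only at h1
    linarith
  rw [div_lt_iff₀ hγ0, inv_mul_eq_div, lt_div_iff₀ hHt] at h4
  linarith

lemma H_lt_gammaβ (S : BranchSolution β H φ x) (hβ : 0 < β) (hβ1 : β < 1 / 2)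
    {t : ℝ} (ht : t < 0) : H t < gammaβ β := by
  have := gammaβ_gt hβ
  refine (S.H_past_upper hβ hβ1 ht).trans_le (div_le_self (by linarith) ?_)
  nlinarith [pow_pos hβ 3]

lemma exp_phi_mul_H_gt (S : BranchSolution β H φ x) (hβ : 0 < β) (hβ1 : β < 1 / 2)
    {t : ℝ} (ht : t < 0) : β - thetaβ β * t < Real.exp (φ t) * H t := by
  have : 0 < Real.exp (φ t) * H t - (β - thetaβ β * t) := by
    refine pos_of_hasDerivAt_neg (f := fun t => Real.exp (φ t) * H t - (β - thetaβ β * t))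
      (f' := fun t => thetaβ β - x t * (branchRate (x t) - hubbleSlope (branchRate (x t))))
      (by simp [S.phi_zero, S.H_zero]) (fun s _ => ?_) (fun s hs => ?_) ht
    · refine (((S.hasDerivAt_phi s).exp.fun_mul (S.hasDerivAt_H s)).fun_sub
        (((hasDerivAt_id' s).const_mul (thetaβ β)).const_sub β)).congr_deriv ?_
      generalize branchRate (x s) = p
      rw [S.x_eq]
      ring
    · have h1 := S.sq_lt_x hs
      have h2 := one_lt_branchRate_sub_hubbleSlope (S.x_pos s)
      have h3 := thetaβ_le hβ hβ1
      nlinarith [S.x_pos s]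
  linarith

lemma H_past_upper_exp (S : BranchSolution β H φ x) (hβ : 0 < β) (hβ1 : β < 1 / 2)
    {t : ℝ} (ht : t < 0) :
    Real.exp (6 * gammaβ β * t) *
        (1 / β ^ 2 - 4 * β / (5 * gammaβ β) + 2 * thetaβ β / (15 * (gammaβ β) ^ 2)) -
      2 * (-6 * β * gammaβ β + thetaβ β + 6 * gammaβ β * thetaβ β * t) /
        (15 * (gammaβ β) ^ 2) < (H t ^ 2)⁻¹ := by
  have hγ := gammaβ_gt hβ
  have hγ0 : 0 < gammaβ β := by linarith
  generalize hC : 1 / β ^ 2 - 4 * β / (5 * gammaβ β) + 2 * thetaβ β / (15 * (gammaβ β) ^ 2) = C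
  have h : 0 < Real.exp (-(6 * gammaβ β * t)) * ((H t ^ 2)⁻¹ +
      2 * (-6 * β * gammaβ β + thetaβ β + 6 * gammaβ β * thetaβ β * t) /
        (15 * (gammaβ β) ^ 2)) - C := by
    refine pos_of_hasDerivAt_neg
      (f := fun t => Real.exp (-(6 * gammaβ β * t)) * ((H t ^ 2)⁻¹ +
        2 * (-6 * β * gammaβ β + thetaβ β + 6 * gammaβ β * thetaβ β * t) /
          (15 * (gammaβ β) ^ 2)) - C)
      (f' := fun t => Real.exp (-(6 * gammaβ β * t)) * (2 * (H t)⁻¹ *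
        (12 / 5 * (β - thetaβ β * t) * H t - 3 * (gammaβ β / H t) -
          hubbleSlope (branchRate (x t)))))
      ?_ (fun s _ => ?_) (fun s hs => ?_) ht
    · simp only [S.H_zero, ← hC]
      norm_num
      field_simp
      ring
    · have h1 := (S.H_pos s).ne'
      have h2 := ((hasDerivAt_id' s).const_mul (6 * gammaβ β)).fun_neg.exp
      have h3 := ((S.hasDerivAt_H s).fun_pow 2).fun_inv (pow_ne_zero 2 h1)
      have h4 := ((((hasDerivAt_id' s).const_mul (6 * gammaβ β * thetaβ β)).const_add
        (-6 * β * gammaβ β + thetaβ β)).const_mul 2).div_const (15 * (gammaβ β) ^ 2)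
      refine ((h2.fun_mul (h3.fun_add h4)).sub_const C).congr_deriv ?_
      norm_num
      field_simp
      ring
    · have h1 := S.H_pos s
      have h2 := S.exp_phi_mul_H_gt hβ hβ1 hs
      have h3 := lt_hubbleSlope_branchRate (S.x_pos s)
      have h4 : (β - thetaβ β * s) * H s < x s := by
        rw [S.x_eq, pow_two, ← mul_assoc]
        exact mul_lt_mul_of_pos_right h2 h1
      have h5 : 1 < gammaβ β / H s := by
        rw [one_lt_div h1]
        exact S.H_lt_gammaβ hβ hβ1 hs
      refine mul_neg_of_pos_of_neg (Real.exp_pos _)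
        (mul_neg_of_pos_of_neg (by positivity) ?_)
      linarith
  rw [Real.exp_neg, sub_pos, inv_mul_eq_div, lt_div_iff₀ (Real.exp_pos _)] at h
  linarith

lemma H_lt_Hupper (S : BranchSolution β H φ x) (hβ : 0 < β) (hβ1 : β < 1 / 2)
    {t : ℝ} (ht : t < 0) : H t < Hupper β t := by
  refine lt_min ?_ (S.H_past_upper hβ hβ1 ht)
  have h := S.H_past_upper_exp hβ hβ1 ht
  have h0 := S.H_pos t
  have hγ := gammaβ_gt hβ
  have hγ0 : 0 < gammaβ β := by linarith
  have hθ := thetaβ_le hβ hβ1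
  have hθ0 := thetaβ_pos hβ
  set G := Real.exp (6 * gammaβ β * t) *
      (1 / β ^ 2 - 4 * β / (5 * gammaβ β) + 2 * thetaβ β / (15 * (gammaβ β) ^ 2)) -
    2 * (-6 * β * gammaβ β + thetaβ β + 6 * gammaβ β * thetaβ β * t) /
      (15 * (gammaβ β) ^ 2) with hG
  have hGpos : 0 < G := by
    have h1 : 4 * β / (5 * gammaβ β) < 1 / β ^ 2 := by
      rw [div_lt_div_iff₀ (by positivity) (by positivity)]
      nlinarith
    have h2 : 0 < 2 * thetaβ β / (15 * (gammaβ β) ^ 2) := by positivity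
    have h3 : 2 * (-6 * β * gammaβ β + thetaβ β + 6 * gammaβ β * thetaβ β * t) /
        (15 * (gammaβ β) ^ 2) < 0 := by
      refine div_neg_of_neg_of_pos ?_ (by positivity)
      have : 6 * gammaβ β * thetaβ β * t < 0 := mul_neg_of_pos_of_neg (by positivity) ht
      nlinarith
    have h4 := mul_pos (Real.exp_pos (6 * gammaβ β * t)) (show 0 < 1 / β ^ 2 -
      4 * β / (5 * gammaβ β) + 2 * thetaβ β / (15 * (gammaβ β) ^ 2) by linarith)
    linarith
  calc H t = ((H t ^ 2)⁻¹) ^ (-(1 / 2) : ℝ) := by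
        rw [Real.inv_rpow (by positivity), ← Real.rpow_neg (by positivity), neg_neg,
          ← Real.sqrt_eq_rpow, Real.sqrt_sq h0.le]
    _ < G ^ (-(1 / 2) : ℝ) := Real.rpow_lt_rpow_of_neg hGpos h (by norm_num)

lemma log_x_mul_H_lt (S : BranchSolution β H φ x) (hβ : 0 < β) (hβ1 : β < 1 / 2)
    {t : ℝ} (ht : t < 0) :
    φ t + 3 * Real.log (H t) <
      3 * Real.log β + 4 * gammaβ β / β ^ 3 * Real.log (1 - 3 * β ^ 3 * t) := by
  have : 0 < 3 * Real.log β + 4 * gammaβ β / β ^ 3 * Real.log (1 - 3 * β ^ 3 * t) -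
      (φ t + 3 * Real.log (H t)) := by
    refine pos_of_hasDerivAt_neg (f := fun t => 3 * Real.log β +
        4 * gammaβ β / β ^ 3 * Real.log (1 - 3 * β ^ 3 * t) - (φ t + 3 * Real.log (H t)))
      (f' := fun t => H t * (branchRate (x t) - 3 * hubbleSlope (branchRate (x t))) -
        12 * (gammaβ β / (1 - 3 * β ^ 3 * t)))
      (by simp [S.phi_zero, S.H_zero]) (fun s hs => ?_) (fun s hs => ?_) ht
    · have h0 : 0 < 1 - 3 * β ^ 3 * s := by nlinarith [pow_pos hβ 3]
      have h1 := (S.H_pos s).ne'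
      refine ((((((hasDerivAt_id' s).const_mul (3 * β ^ 3)).const_sub 1).log h0.ne').const_mul
        (4 * gammaβ β / β ^ 3)).const_add (3 * Real.log β)).fun_sub
        ((S.hasDerivAt_phi s).fun_add (((S.hasDerivAt_H s).log h1).const_mul 3)) |>.congr_deriv ?_
      field_simp
      ring
    · have h1 := S.H_pos s
      have h2 := S.H_past_upper hβ hβ1 hs
      have h3 := mul_lt_mul_of_pos_left (branchRate_sub_three_mul_hubbleSlope_lt (S.x_pos s)) h1
      linarith
  linarith

lemma phi_past_upper (S : BranchSolution β H φ x) (hβ : 0 < β) (hβ1 : β < 1 / 2)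
    {t : ℝ} (ht : t < 0) : φ t < phiupper β t := by
  have hγ := gammaβ_gt hβ
  have hγ0 : 0 < gammaβ β := by linarith
  have : 0 < phiupper β t - φ t := by
    refine pos_of_hasDerivAt_neg (f := fun t => phiupper β t - φ t)
      (f' := fun t => branchRate (x t) * H t - Real.sqrt 6 * (gammaβ β / (1 - 3 * β ^ 3 * t)) -
        6 * (β ^ 3 * (1 - 3 * β ^ 3 * t) ^ (4 * gammaβ β / β ^ 3)))
      (by simp [S.phi_zero, phiupper]) (fun s hs => ?_) (fun s hs => ?_) ht
    · have h0 : 0 < 1 - 3 * β ^ 3 * s := by nlinarith [pow_pos hβ 3]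
      have h1 := ((hasDerivAt_id' s).const_mul (3 * β ^ 3)).const_sub 1
      refine ((((h1.log h0.ne').const_mul (Real.sqrt 6 * gammaβ β / (3 * β ^ 3))).fun_add
        (((h1.rpow_const (p := (4 * gammaβ β + β ^ 3) / β ^ 3) (Or.inl h0.ne')).sub_const
          1).const_mul (2 * β ^ 3 / (4 * gammaβ β + β ^ 3)))).fun_sub
        (S.hasDerivAt_phi s)).congr_deriv ?_
      have e : (4 * gammaβ β + β ^ 3) / β ^ 3 - 1 = 4 * gammaβ β / β ^ 3 := by field_simp; ring
      rw [e]
      field_simp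
      ring
    · have h0 : 0 < 1 - 3 * β ^ 3 * s := by nlinarith [pow_pos hβ 3]
      have h1 := S.H_pos s
      have h2 := S.H_past_upper hβ hβ1 hs
      have h3 := branchRate_lt (S.x_pos s)
      have h4 : x s * H s < β ^ 3 * (1 - 3 * β ^ 3 * s) ^ (4 * gammaβ β / β ^ 3) := by
        have h := Real.exp_lt_exp.2 (S.log_x_mul_H_lt hβ hβ1 hs)
        have e : ∀ y : ℝ, 0 < y → Real.exp (3 * Real.log y) = y ^ 3 := fun y hy => by
          rw [← Real.exp_log (pow_pos hy 3), Real.log_pow, Nat.cast_ofNat]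
        rw [Real.exp_add, Real.exp_add, e _ h1, e _ hβ, mul_comm (4 * gammaβ β / β ^ 3),
          ← Real.rpow_def_of_pos h0] at h
        rw [S.x_eq]
        linarith
      have h5 := mul_lt_mul_of_pos_right h3 h1
      have h6 := mul_lt_mul_of_pos_left h2 (show 0 < Real.sqrt 6 by positivity)
      linarith
  linarith

lemma log_exp_phi_mul_H_lt (S : BranchSolution β H φ x) (hβ : 0 < β) (hβ1 : β < 1 / 2)
    {t : ℝ} (ht : t < 0) :
    φ t + 11 / 4 * Real.log (H t) <
      11 / 4 * Real.log β + mβ β * Real.log (1 - 3 * β ^ 3 * t) := by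
  have : 0 < 11 / 4 * Real.log β + mβ β * Real.log (1 - 3 * β ^ 3 * t) -
      (φ t + 11 / 4 * Real.log (H t)) := by
    refine pos_of_hasDerivAt_neg (f := fun t => 11 / 4 * Real.log β +
        mβ β * Real.log (1 - 3 * β ^ 3 * t) - (φ t + 11 / 4 * Real.log (H t)))
      (f' := fun t => H t * (branchRate (x t) - 11 / 4 * hubbleSlope (branchRate (x t))) -
        3 * β ^ 3 * mβ β / (1 - 3 * β ^ 3 * t))
      (by simp [S.phi_zero, S.H_zero]) (fun s hs => ?_) (fun s hs => ?_) ht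
    · have h0 : 0 < 1 - 3 * β ^ 3 * s := by nlinarith [pow_pos hβ 3]
      have h1 := (S.H_pos s).ne'
      refine ((((((hasDerivAt_id' s).const_mul (3 * β ^ 3)).const_sub 1).log h0.ne').const_mul
        (mβ β)).const_add (11 / 4 * Real.log β)).fun_sub
        ((S.hasDerivAt_phi s).fun_add (((S.hasDerivAt_H s).log h1).const_mul (11 / 4)))
        |>.congr_deriv ?_
      field_simp
      ring
    · have h0 : 0 < 1 - 3 * β ^ 3 * s := by nlinarith [pow_pos hβ 3]
      have h1 := S.H_pos s
      have h2 := S.H_mul_lt_sqrt_x hβ hs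
      have h3 := sqrt_mul_slope_defect_le (S.x_pos s)
      have hγ := gammaβ_gt hβ
      have hβ3 : β ^ 3 < 1 / 8 := by
        calc β ^ 3 < (1 / 2) ^ 3 := pow_lt_pow_left₀ hβ1 hβ.le (by norm_num)
          _ = 1 / 8 := by norm_num
      rw [mβ_mul hβ, sub_neg, lt_div_iff₀ h0]
      generalize branchRate (x s) - 11 / 4 * hubbleSlope (branchRate (x s)) = d at *
      have h4 : H s * d * (1 - 3 * β ^ 3 * s) ≤ 18 := by
        rcases le_or_gt d 0 with hd | hd
        · have : H s * d * (1 - 3 * β ^ 3 * s) ≤ 0 :=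
            mul_nonpos_of_nonpos_of_nonneg (mul_nonpos_of_nonneg_of_nonpos h1.le hd) h0.le
          linarith
        · have := mul_lt_mul_of_pos_right h2 hd
          linarith
      linarith
  linarith

lemma Hlower_lt_H (S : BranchSolution β H φ x) (hβ : 0 < β) (hβ1 : β < 1 / 2)
    {t : ℝ} (ht : t < 0) : Hlower β t < H t ∧ 0 < Hlower β t := by
  have hγ := gammaβ_gt hβ
  have hm := mβ_mul hβ
  have hβ3 : β ^ 3 < 1 / 8 := by
    calc β ^ 3 < (1 / 2) ^ 3 := pow_lt_pow_left₀ hβ1 hβ.le (by norm_num)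
      _ = 1 / 8 := by norm_num
  have hm0 : 0 < mβ β := by
    refine pos_of_mul_pos_right (a := 3 * β ^ 3) ?_ (by positivity)
    linarith
  have h : 0 < β ^ (-(1 / 4) : ℝ) - β ^ (-(1 / 4) : ℝ) / (4 * (mβ β + 1)) *
      (1 - (1 - 3 * β ^ 3 * t) ^ (mβ β + 1)) - H t ^ (-(1 / 4) : ℝ) := by
    refine pos_of_hasDerivAt_neg
      (f := fun t => β ^ (-(1 / 4) : ℝ) - β ^ (-(1 / 4) : ℝ) / (4 * (mβ β + 1)) *
        (1 - (1 - 3 * β ^ 3 * t) ^ (mβ β + 1)) - H t ^ (-(1 / 4) : ℝ))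
      (f' := fun t => 1 / 4 * (H t ^ (3 / 4 : ℝ) * hubbleSlope (branchRate (x t)) -
        3 * (β ^ (11 / 4 : ℝ) * (1 - 3 * β ^ 3 * t) ^ mβ β)))
      (by simp [S.H_zero]) (fun s hs => ?_) (fun s hs => ?_) ht
    · have h0 : 0 < 1 - 3 * β ^ 3 * s := by nlinarith [pow_pos hβ 3]
      have h1 := S.H_pos s
      have h2 := ((((hasDerivAt_id' s).const_mul (3 * β ^ 3)).const_sub 1).rpow_const
        (p := mβ β + 1) (Or.inl h0.ne')).const_sub 1
      refine (((h2.const_mul (β ^ (-(1 / 4) : ℝ) / (4 * (mβ β + 1)))).const_sub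
        (β ^ (-(1 / 4) : ℝ))).fun_sub
        ((S.hasDerivAt_H s).rpow_const (p := (-(1 / 4) : ℝ)) (Or.inl h1.ne'))).congr_deriv ?_
      have e1 : β ^ (11 / 4 : ℝ) = β ^ (-(1 / 4) : ℝ) * β ^ 3 := by
        rw [← Real.rpow_natCast, ← Real.rpow_add hβ]
        norm_num
      have e2 : H s ^ (3 / 4 : ℝ) = H s ^ (-(1 / 4) - 1 : ℝ) * H s ^ 2 := by
        rw [← Real.rpow_natCast, ← Real.rpow_add h1]
        norm_num
      rw [e1, e2, add_sub_cancel_right]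
      field_simp
      ring
    · have h0 : 0 < 1 - 3 * β ^ 3 * s := by nlinarith [pow_pos hβ 3]
      have h1 := S.H_pos s
      have h2 := hubbleSlope_branchRate_lt (S.x_pos s)
      have h3 : x s * H s ^ (3 / 4 : ℝ) < β ^ (11 / 4 : ℝ) * (1 - 3 * β ^ 3 * s) ^ mβ β := by
        have h := Real.exp_lt_exp.2 (S.log_exp_phi_mul_H_lt hβ hβ1 hs)
        rw [Real.exp_add, Real.exp_add, mul_comm (11 / 4), mul_comm (11 / 4), mul_comm (mβ β),
          ← Real.rpow_def_of_pos h0, ← Real.rpow_def_of_pos h1, ← Real.rpow_def_of_pos hβ] at h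
        have e : H s ^ (11 / 4 : ℝ) = H s ^ 2 * H s ^ (3 / 4 : ℝ) := by
          rw [← Real.rpow_natCast, ← Real.rpow_add h1]
          norm_num
        rw [e, ← mul_assoc] at h
        rwa [S.x_eq]
      have h4 : 0 < H s ^ (3 / 4 : ℝ) := Real.rpow_pos_of_pos h1 _
      have h5 := mul_lt_mul_of_pos_left h2 h4
      have h6 : 0 < x s * H s ^ (3 / 4 : ℝ) := mul_pos (S.x_pos s) h4
      linarith
  have h1 := S.H_pos t
  have h2 : 0 < H t ^ (-(1 / 4) : ℝ) := Real.rpow_pos_of_pos h1 _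
  refine ⟨?_, Real.rpow_pos_of_pos (by linarith) _⟩
  calc Hlower β t < (H t ^ (-(1 / 4) : ℝ)) ^ (-4 : ℝ) :=
        Real.rpow_lt_rpow_of_neg h2 (by linarith) (by norm_num)
    _ = H t := by
        rw [← Real.rpow_mul h1.le]
        norm_num

end BranchSolution

/-- Main theorem: for every `0 < β < √6/6` there is a globally defined,
singularity-free solution `(H, φ)` of the EdGB FLRW system on all of `ℝ` with the
negative-branch initial data with parameter `β`, satisfying the stated two-sided
bounds on `H` and `φ` for future times `t > 0` and past times `t < 0`. -/
theorem stmt_19 (β : ℝ) (hβ : 0 < β) (hβ' : β < Real.sqrt 6 / 6) :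
    ∃ H φ : ℝ → ℝ, ContDiff ℝ 1 H ∧ ContDiff ℝ 2 φ ∧
      EdGB H φ Set.univ ∧ NegBranchData H φ β ∧
      (∀ t : ℝ, 0 < t →
        (1 / (5 * t + 1 / β) < H t ∧ H t < 1 / ((1 / 2) * t + 1 / β)) ∧
        (-(12 * β ^ 2 + 2 * Real.sqrt 6) * Real.log ((1 / 2) * β * t + 1) < φ t ∧
          φ t < -Real.log (1 + (3 / 5) * (β ^ 2 - 1 / (5 * t + 1 / β) ^ 2)))) ∧
      (∀ t : ℝ, t < 0 →
        H t < Hupper β t ∧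
        (H t > Hlower β t ∧ Hlower β t > 0) ∧
        (Real.log ((1 - 3 * β ^ 3 * t) ^ 2) < φ t ∧ φ t < phiupper β t)) := by
  have h6 := Real.sq_sqrt (show (0 : ℝ) ≤ 6 by norm_num)
  have hβ2 : β ^ 2 < 1 / 6 := by
    calc β ^ 2 < (Real.sqrt 6 / 6) ^ 2 := pow_lt_pow_left₀ hβ' hβ.le (by norm_num)
      _ = 1 / 6 := by rw [div_pow, h6]; norm_num
  have hβ1 : β < 1 / 2 := by nlinarith
  obtain ⟨H, φ, x, S⟩ := exists_branchSolution hβ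
  exact ⟨H, φ, S.contDiff_H, S.contDiff_phi, S.edGB, S.negBranchData hβ hβ',
    fun t ht => ⟨S.H_future_bounds hβ hβ2 ht, S.phi_future_lower hβ hβ2 ht,
      S.phi_future_upper hβ hβ2 ht⟩,
    fun t ht => ⟨S.H_lt_Hupper hβ hβ1 ht, S.Hlower_lt_H hβ hβ1 ht,
      S.phi_past_lower hβ ht, S.phi_past_upper hβ hβ1 ht⟩⟩
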